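/- arXiv:2210.05138 — 2 statements merged into one kernel-verified Lean document; each statement's English description precedes it below -/
import Mathlib

section
/- Let H be a finite-dimensional complex inner product space, U a unitary operator on H, and ψ ∈ H a unit vector. Let Π₀ and Π₁ be orthogonal projections on H with Π₀Π₁ = 0, and set Π := Π₀ + Π₁. Let G₀ and G₁ be unitary operators on H with G₀Π₀ = Π₀G₀ and G₁Π₁ = Π₁G₁, and define G := Π₀G₀ + Π₁G₁ + (1 − Π) and G̃₀ := Π₀G₀ + (1 − Π₀). For each integer t ≥ 0 define ε(t) := max over integers q, r, s with 0 ≤ q, r, s ≤ t of ‖Π₁ U^q Π₀ (G̃₀)^r (U G̃₀)^s Π₀ ψ‖. Then for every integer t ≥ 0 one has ‖Π₁ (U G)^t Π₀ ψ‖ ≤ 4 t² · ε(t). -/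
section UnitaryPerturbation

variable {H : Type*} [NormedAddCommGroup H] [InnerProductSpace ℂ H]

/-- A unitary linear map preserves norms. -/
lemma norm_apply_of_mem_unitary [FiniteDimensional ℂ H] {V : H →ₗ[ℂ] H}
    (hV : V ∈ unitary (H →ₗ[ℂ] H)) (x : H) :
    ‖V x‖ = ‖x‖ := by
  have h : LinearMap.adjoint V (V x) = x := by
    have h' := LinearMap.congr_fun (Unitary.star_mul_self_of_mem hV) x
    simpa [LinearMap.star_eq_adjoint] using h'
  have h₂ : inner ℂ (V x) (V x) = inner ℂ x x := by
    rw [← LinearMap.adjoint_inner_right, h]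
  rw [@norm_eq_sqrt_re_inner ℂ, @norm_eq_sqrt_re_inner ℂ _ _ _ _ x, h₂]

/-- An orthogonal projection does not increase norms. -/
lemma norm_apply_le_of_isStarProjection [FiniteDimensional ℂ H] {P : H →ₗ[ℂ] H}
    (hP : IsIdempotentElem P)
    (hPsa : IsSelfAdjoint P) (x : H) : ‖P x‖ ≤ ‖x‖ := by
  have hid : P (P x) = P x := LinearMap.congr_fun hP x
  have hadj : LinearMap.adjoint P = P := hPsa
  have h : inner ℂ (P x) (P x) = inner ℂ x (P x) := by
    rw [← LinearMap.adjoint_inner_right, hadj, hid]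
  have h₂ : ‖P x‖ * ‖P x‖ ≤ ‖x‖ * ‖P x‖ := by
    rw [← @inner_self_eq_norm_mul_norm ℂ, h]
    exact re_inner_le_norm x (P x)
  by_contra! hlt
  nlinarith [norm_nonneg x]

/-- Restricting the action of a unitary to the range of a commuting projection, and acting as the
identity on the orthogonal complement, yields a unitary. -/
lemma mul_add_one_sub_mem_unitary {R : Type*} [Ring R] [StarRing R] {P V : R}
    (hP : IsIdempotentElem P) (hPsa : IsSelfAdjoint P) (hV : V ∈ unitary R)
    (hc : V * P = P * V) : P * V + (1 - P) ∈ unitary R := by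
  have hPP : P * P = P := hP
  have hs : star P = P := hPsa
  have hc' : P * star V = star V * P := by simpa [hs] using congrArg star hc
  have h₁ : star V * V = 1 := Unitary.star_mul_self_of_mem hV
  have h₂ : V * star V = 1 := Unitary.mul_star_self_of_mem hV
  have hstar : star (P * V + (1 - P)) = star V * P + (1 - P) := by simp [hs]
  rw [Unitary.mem_iff, hstar]
  constructor
  · calc (star V * P + (1 - P)) * (P * V + (1 - P))
        = star V * (P * P) * V + star V * (P - P * P) + (P - P * P) * V + (1 - P - P + P * P) := by
          noncomm_ring
      _ = star V * (V * P) + (1 - P) := by rw [hPP, hc]; noncomm_ring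
      _ = 1 := by rw [← mul_assoc, h₁]; noncomm_ring
  · calc (P * V + (1 - P)) * (star V * P + (1 - P))
        = P * (V * star V) * P + (P * V) * (1 - P) + (1 - P) * (star V * P) + (1 - P - P + P * P)
          := by noncomm_ring
      _ = P * P + V * (P - P * P) + star V * (P * P) - P * (star V * P) + (1 - P - P + P * P)
          - (star V * P * P - star V * P) := by
          rw [h₂, ← hc]; noncomm_ring
      _ = 1 := by rw [← mul_assoc P, hc', mul_assoc (star V), hPP]; noncomm_ring

/-- If `A` is a contraction, then `A ^ n` and `B ^ n` differ on `x` by at most the accumulated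
one-step errors along the orbit of `x` under `B`. -/
lemma norm_pow_sub_pow_apply_le {A B : H →ₗ[ℂ] H} (hA : ∀ x, ‖A x‖ ≤ ‖x‖) (x : H) (n : ℕ) :
    ‖(A ^ n) x - (B ^ n) x‖ ≤ ∑ j ∈ Finset.range n, ‖(A - B) ((B ^ j) x)‖ := by
  induction n with
  | zero => simp
  | succ n ih =>
    have h : (A ^ (n + 1)) x - (B ^ (n + 1)) x
        = A ((A ^ n) x - (B ^ n) x) + (A - B) ((B ^ n) x) := by
      simp [pow_succ']
    rw [h, Finset.sum_range_succ]
    exact (norm_add_le _ _).trans (by gcongr; exact (hA _).trans ih)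

/-- If inserting the projection `P` between `U` and `V` produces errors at most `ε` along the orbit
of `x` under `U * V`, then this orbit stays almost in the kernel of `Q`. -/
lemma norm_apply_pow_mul_pow_le {Q U P V : H →ₗ[ℂ] H} (hPV : P * V = V - 1 + P) {x : H} {ε : ℝ}
    {t : ℕ} (hx : ∀ q ≤ t, ‖Q ((U ^ q) x)‖ ≤ ε)
    (hε : ∀ q s, q + s ≤ t → ‖Q ((U ^ q) (P (((U * V) ^ s) x)))‖ ≤ ε)
    (hεV : ∀ q s, q + s ≤ t → 0 < q → ‖Q ((U ^ q) (P (V (((U * V) ^ s) x))))‖ ≤ ε)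
    (s q : ℕ) (hqs : q + s ≤ t) :
    ‖Q ((U ^ q) (((U * V) ^ s) x))‖ ≤ (2 * s + 1) * ε := by
  induction s generalizing q with
  | zero => simpa using hx q (by omega)
  | succ s ih =>
    set y := ((U * V) ^ s) x
    have hPVy : V y = y + P (V y) - P y := by
      have h := LinearMap.congr_fun hPV y
      simp only [Module.End.mul_apply, LinearMap.add_apply, LinearMap.sub_apply,
        Module.End.one_apply] at h
      rw [h]; abel
    have h : Q ((U ^ q) (((U * V) ^ (s + 1)) x))
        = Q ((U ^ (q + 1)) y) + Q ((U ^ (q + 1)) (P (V y))) - Q ((U ^ (q + 1)) (P y)) := by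
      rw [← map_add, ← map_sub, ← map_add, ← map_sub, ← hPVy, pow_succ', pow_succ]
      rfl
    rw [h]
    have h₁ := ih (q + 1) (by omega)
    have h₂ := hεV (q + 1) s (by omega) (by omega)
    have h₃ := hε (q + 1) s (by omega)
    have h₄ := norm_sub_le (Q ((U ^ (q + 1)) y) + Q ((U ^ (q + 1)) (P (V y))))
      (Q ((U ^ (q + 1)) (P y)))
    have h₅ := norm_add_le (Q ((U ^ (q + 1)) y)) (Q ((U ^ (q + 1)) (P (V y))))
    push_cast
    linarith

end UnitaryPerturbation

/-- **Lemma 5.6 (main operator-norm bound for admissible oracles).**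
`H` is a finite-dimensional complex inner product space; `P₀, P₁` are orthogonal projections
with `P₀ * P₁ = 0`; `U, G₀, G₁` are unitaries with `G₀` commuting with `P₀` and `G₁` commuting
with `P₁`; `G = P₀G₀ + P₁G₁ + (1 - (P₀ + P₁))`, `G₀' = P₀G₀ + (1 - P₀)` (this is `G̃₀`);
`ε` is the maximum of `‖P₁ U^q P₀ (G₀')^r (U G₀')^s P₀ ψ‖` over `q, r, s ≤ t`.
Then `‖P₁ (U G)^t P₀ ψ‖ ≤ 4 t² ε`. -/
theorem stmt_0 {H : Type*} [NormedAddCommGroup H] [InnerProductSpace ℂ H]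
    [FiniteDimensional ℂ H]
    (U G₀ G₁ P₀ P₁ : H →ₗ[ℂ] H)
    (hU : U ∈ unitary (H →ₗ[ℂ] H))
    (hG₀ : G₀ ∈ unitary (H →ₗ[ℂ] H))
    (hG₁ : G₁ ∈ unitary (H →ₗ[ℂ] H))
    (hP₀ : IsIdempotentElem P₀) (hP₀sa : IsSelfAdjoint P₀)
    (hP₁ : IsIdempotentElem P₁) (hP₁sa : IsSelfAdjoint P₁)
    (horth : P₀ * P₁ = 0)
    (hc₀ : G₀ * P₀ = P₀ * G₀) (hc₁ : G₁ * P₁ = P₁ * G₁)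
    (ψ : H) (hψ : ‖ψ‖ = 1)
    (G G₀' : H →ₗ[ℂ] H)
    (hG : G = P₀ * G₀ + P₁ * G₁ + (1 - (P₀ + P₁)))
    (hG₀' : G₀' = P₀ * G₀ + (1 - P₀))
    (t : ℕ) (ε : ℝ)
    (hε : ε = sSup {x : ℝ | ∃ q r s : ℕ, q ≤ t ∧ r ≤ t ∧ s ≤ t ∧
      x = ‖(P₁ * U ^ q * P₀ * G₀' ^ r * (U * G₀') ^ s * P₀) ψ‖}) :
    ‖(P₁ * (U * G) ^ t * P₀) ψ‖ ≤ 4 * (t : ℝ) ^ 2 * ε := by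
  have hP₀P₀ : P₀ * P₀ = P₀ := hP₀
  have horth' : P₁ * P₀ = 0 := by
    simpa [hP₀sa.star_eq, hP₁sa.star_eq] using congrArg star horth
  have hφ : P₁ (P₀ ψ) = 0 := LinearMap.congr_fun horth' ψ
  have hbound : ∀ q r s : ℕ, q ≤ t → r ≤ t → s ≤ t →
      ‖(P₁ * U ^ q * P₀ * G₀' ^ r * (U * G₀') ^ s * P₀) ψ‖ ≤ ε := by
    intro q r s hq hr hs
    rw [hε]
    refine le_csSup (Set.Finite.bddAbove ?_) ⟨q, r, s, hq, hr, hs, rfl⟩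
    refine ((Set.finite_Iic (t, t, t)).image fun p : ℕ × ℕ × ℕ =>
      ‖(P₁ * U ^ p.1 * P₀ * G₀' ^ p.2.1 * (U * G₀') ^ p.2.2 * P₀) ψ‖).subset ?_
    rintro x ⟨q, r, s, hq, hr, hs, rfl⟩
    exact ⟨(q, r, s), ⟨hq, hr, hs⟩, rfl⟩
  have hε₀ : 0 ≤ ε := (norm_nonneg _).trans (hbound 0 0 0 t.zero_le t.zero_le t.zero_le)
  have hPG : P₀ * G₀' = G₀' - 1 + P₀ := by
    rw [hG₀', mul_add, mul_sub, mul_one, ← mul_assoc, hP₀P₀]; abel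
  have hB : ∀ s ≤ t, ‖P₁ (((U * G₀') ^ s) (P₀ ψ))‖ ≤ 3 * s * ε := by
    intro s hs
    rcases Nat.eq_zero_or_pos s with rfl | hpos
    · simp [hφ]
    have h := norm_apply_pow_mul_pow_le (Q := P₁) (U := U) (x := P₀ ψ) (ε := ε) (t := t) hPG
      (fun q hq => by
        have h := hbound q 0 0 hq t.zero_le t.zero_le
        rwa [pow_zero, pow_zero, mul_one, mul_one, mul_assoc, hP₀P₀] at h)
      (fun q s hqs => by simpa using hbound q 0 s (by omega) t.zero_le (by omega))
      (fun q s hqs hq => by simpa using hbound q 1 s (by omega) (by omega) (by omega))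
      s 0 (by omega)
    have hs₁ : (1 : ℝ) ≤ s := by exact_mod_cast hpos
    refine (by simpa using h : _ ≤ (2 * (s : ℝ) + 1) * ε).trans ?_
    gcongr
    linarith
  have hGfac : G = G₀' * (P₁ * G₁ + (1 - P₁)) := by
    have h : P₀ * G₀ * P₁ = 0 := by rw [← hc₀, mul_assoc, horth, mul_zero]
    rw [hG, hG₀']
    calc P₀ * G₀ + P₁ * G₁ + (1 - (P₀ + P₁))
        = P₀ * G₀ * P₁ * (G₁ - 1) - P₀ * P₁ * (G₁ - 1) + P₀ * G₀ + P₁ * G₁ + (1 - (P₀ + P₁)) := by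
          rw [h, horth]; simp
      _ = _ := by noncomm_ring
  have hGu : U * G ∈ unitary (H →ₗ[ℂ] H) := by
    rw [hGfac, hG₀']
    exact mul_mem hU (mul_mem (mul_add_one_sub_mem_unitary hP₀ hP₀sa hG₀ hc₀)
      (mul_add_one_sub_mem_unitary hP₁ hP₁sa hG₁ hc₁))
  have hdiff : ∀ x, ‖(U * G - U * G₀') x‖ ≤ 2 * ‖P₁ x‖ := by
    intro x
    have h : U * G - U * G₀' = U * (G₁ * P₁ - P₁) := by
      rw [hG, hG₀', hc₁]; noncomm_ring
    rw [h]
    calc ‖(U * (G₁ * P₁ - P₁)) x‖ = ‖G₁ (P₁ x) - P₁ x‖ := norm_apply_of_mem_unitary hU _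
      _ ≤ ‖G₁ (P₁ x)‖ + ‖P₁ x‖ := norm_sub_le _ _
      _ = 2 * ‖P₁ x‖ := by rw [norm_apply_of_mem_unitary hG₁]; ring
  have hsum : ∀ n ≤ t, ∑ j ∈ Finset.range n, ‖(U * G - U * G₀') (((U * G₀') ^ j) (P₀ ψ))‖
      ≤ 3 * n * (n - 1) * ε := by
    intro n
    induction n with
    | zero => simp
    | succ n ih =>
      intro hn
      rw [Finset.sum_range_succ]
      have h₁ := ih (by omega)
      have h₂ := hdiff (((U * G₀') ^ n) (P₀ ψ))
      have h₃ := hB n (by omega)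
      push_cast
      linarith
  have htel := (norm_apply_le_of_isStarProjection hP₁ hP₁sa _).trans
    ((norm_pow_sub_pow_apply_le (A := U * G) (B := U * G₀')
      (fun x => (norm_apply_of_mem_unitary hGu x).le) (P₀ ψ) t).trans (hsum t le_rfl))
  rw [map_sub] at htel
  have h₁ := norm_le_norm_add_norm_sub' (P₁ (((U * G) ^ t) (P₀ ψ))) (P₁ (((U * G₀') ^ t) (P₀ ψ)))
  have h₂ := hB t le_rfl
  have h₃ : 0 ≤ (t : ℝ) ^ 2 * ε := by positivity
  change ‖P₁ (((U * G) ^ t) (P₀ ψ))‖ ≤ _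
  linarith
end

section
/- Let H be a finite-dimensional complex inner product space, U a unitary operator on H, and ψ ∈ H a unit vector. Let Π₀ and Π₁ be orthogonal projections on H with Π₀Π₁ = 0. Let G₀ be a unitary operator on H with G₀Π₀ = Π₀G₀, and define G̃₀ := Π₀G₀ + (1 − Π₀). For each integer t ≥ 0 define ε(t) := max over integers q, r, s with 0 ≤ q, r, s ≤ t of ‖Π₁ U^q Π₀ (G̃₀)^r (U G̃₀)^s Π₀ ψ‖. Then for every integer t ≥ 0 one has ‖Π₁ (U G̃₀)^t Π₀ ψ‖ ≤ 2 t · ε(t). -/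
/-- The values `A q r s` with `q, r, s ≤ t` of a real-valued family are bounded by their supremum. -/
theorem le_sSup_of_le_of_le_of_le (A : ℕ → ℕ → ℕ → ℝ) {t q r s : ℕ}
    (hq : q ≤ t) (hr : r ≤ t) (hs : s ≤ t) :
    A q r s ≤ sSup {x : ℝ | ∃ q r s : ℕ, q ≤ t ∧ r ≤ t ∧ s ≤ t ∧ x = A q r s} := by
  refine le_csSup (Set.Finite.bddAbove ?_) ⟨q, r, s, hq, hr, hs, rfl⟩
  refine (((Set.finite_Iic t).prod ((Set.finite_Iic t).prod (Set.finite_Iic t))).image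
    fun p : ℕ × ℕ × ℕ => A p.1 p.2.1 p.2.2).subset ?_
  rintro x ⟨q, r, s, hq, hr, hs, rfl⟩
  exact ⟨(q, r, s), ⟨hq, hr, hs⟩, rfl⟩

/-- Replacing the factors `U * G` of `U ^ m * (U * G) ^ (n + 1)` by `U` one at a time costs at most
`2 * ε` each, and the last factor costs `ε`. -/
theorem norm_mul_pow_mul_mul_pow_succ_le {𝕜 H : Type*} [NormedField 𝕜] [NormedAddCommGroup H]
    [NormedSpace 𝕜 H] {U G P Q : H →ₗ[𝕜] H} (hP : IsIdempotentElem P) (hPG : P * G = G * P)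
    (hG : P * (G - 1) = G - 1) {ψ : H} {t : ℕ} {ε : ℝ}
    (hε : ∀ q r s : ℕ, q ≤ t → r ≤ t → s ≤ t →
      ‖(Q * U ^ q * P * G ^ r * (U * G) ^ s * P) ψ‖ ≤ ε) :
    ∀ n m : ℕ, m + n + 1 ≤ t →
      ‖(Q * U ^ m * (U * G) ^ (n + 1) * P) ψ‖ ≤ (2 * n + 1) * ε := by
  intro n
  induction n with
  | zero =>
    intro m hm
    have key : Q * U ^ m * (U * G) ^ (0 + 1) * P =
        Q * U ^ (m + 1) * P * G ^ 1 * (U * G) ^ 0 * P := by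
      have hGP : P * G * P = G * P := by rw [hPG, mul_assoc, hP.eq]
      calc Q * U ^ m * (U * G) ^ (0 + 1) * P = Q * U ^ (m + 1) * (G * P) := by
            simp only [pow_succ, pow_zero, one_mul, mul_assoc]
        _ = _ := by rw [← hGP]; simp only [pow_one, pow_zero, mul_one, mul_assoc]
    rw [key]
    simpa using hε (m + 1) 1 0 (by omega) (by omega) (by omega)
  | succ n ih =>
    intro m hm
    have key : Q * U ^ m * (U * G) ^ (n + 1 + 1) * P =
        Q * U ^ (m + 1) * (U * G) ^ (n + 1) * P
          + (Q * U ^ (m + 1) * P * G ^ 1 * (U * G) ^ (n + 1) * P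
            - Q * U ^ (m + 1) * P * G ^ 0 * (U * G) ^ (n + 1) * P) := by
      have hsplit : G = 1 + (P * G - P) := by
        rw [mul_sub, mul_one] at hG
        rw [hG]; abel
      calc Q * U ^ m * (U * G) ^ (n + 1 + 1) * P
          = Q * U ^ (m + 1) * G * ((U * G) ^ (n + 1) * P) := by
            rw [pow_succ' (U * G) (n + 1), pow_succ U m]; simp only [mul_assoc]
        _ = Q * U ^ (m + 1) * (1 + (P * G - P)) * ((U * G) ^ (n + 1) * P) := by
            rw [← hsplit]
        _ = _ := by
            simp only [pow_one, pow_zero, mul_one, mul_add, add_mul, mul_sub, sub_mul, mul_assoc]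
    rw [key, LinearMap.add_apply, LinearMap.sub_apply]
    have h₀ := hε (m + 1) 0 (n + 1) (by omega) (by omega) (by omega)
    have h₁ := hε (m + 1) 1 (n + 1) (by omega) (by omega) (by omega)
    refine ((norm_add_le _ _).trans (add_le_add (ih (m + 1) (by omega))
      ((norm_sub_le _ _).trans (add_le_add h₁ h₀)))).trans (le_of_eq ?_)
    push_cast
    ring

/-- **Claim 5.7.**
`H` is a finite-dimensional complex inner product space; `P₀, P₁` are orthogonal projections
with `P₀ * P₁ = 0`; `U, G₀` are unitaries with `G₀` commuting with `P₀`;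
`G₀' = P₀G₀ + (1 - P₀)` (this is `G̃₀`);
`ε` is the maximum of `‖P₁ U^q P₀ (G₀')^r (U G₀')^s P₀ ψ‖` over `q, r, s ≤ t`.
Then `‖P₁ (U G₀')^t P₀ ψ‖ ≤ 2 t ε`. -/
theorem stmt_1 {H : Type*} [NormedAddCommGroup H] [InnerProductSpace ℂ H]
    [FiniteDimensional ℂ H]
    (U G₀ P₀ P₁ : H →ₗ[ℂ] H)
    (hU : U ∈ unitary (H →ₗ[ℂ] H))
    (hG₀ : G₀ ∈ unitary (H →ₗ[ℂ] H))
    (hP₀ : IsIdempotentElem P₀) (hP₀sa : IsSelfAdjoint P₀)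
    (hP₁ : IsIdempotentElem P₁) (hP₁sa : IsSelfAdjoint P₁)
    (horth : P₀ * P₁ = 0)
    (hc₀ : G₀ * P₀ = P₀ * G₀)
    (ψ : H) (hψ : ‖ψ‖ = 1)
    (G₀' : H →ₗ[ℂ] H)
    (hG₀' : G₀' = P₀ * G₀ + (1 - P₀))
    (t : ℕ) (ε : ℝ)
    (hε : ε = sSup {x : ℝ | ∃ q r s : ℕ, q ≤ t ∧ r ≤ t ∧ s ≤ t ∧
      x = ‖(P₁ * U ^ q * P₀ * G₀' ^ r * (U * G₀') ^ s * P₀) ψ‖}) :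
    ‖(P₁ * (U * G₀') ^ t * P₀) ψ‖ ≤ 2 * (t : ℝ) * ε := by
  have hbound : ∀ q r s : ℕ, q ≤ t → r ≤ t → s ≤ t →
      ‖(P₁ * U ^ q * P₀ * G₀' ^ r * (U * G₀') ^ s * P₀) ψ‖ ≤ ε := by
    intro q r s hq hr hs
    rw [hε]
    exact le_sSup_of_le_of_le_of_le
      (fun q r s => ‖(P₁ * U ^ q * P₀ * G₀' ^ r * (U * G₀') ^ s * P₀) ψ‖) hq hr hs
  have hε0 : 0 ≤ ε :=
    (norm_nonneg _).trans (hbound 0 0 0 (Nat.zero_le t) (Nat.zero_le t) (Nat.zero_le t))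
  have hcomm : P₀ * G₀' = G₀' * P₀ := by
    rw [hG₀', mul_add, add_mul, mul_sub, sub_mul, mul_one, one_mul, mul_assoc P₀ G₀ P₀, hc₀]
  have hG : P₀ * (G₀' - 1) = G₀' - 1 := by
    have h : G₀' - 1 = P₀ * (G₀ - 1) := by
      rw [hG₀', mul_sub, mul_one]; abel
    rw [h, ← mul_assoc, hP₀.eq]
  rcases t with _ | n
  · have h : P₁ * P₀ = 0 := by
      have := congrArg star horth
      rwa [star_mul, hP₀sa.star_eq, hP₁sa.star_eq, star_zero] at this
    simp [h]
  · have h := norm_mul_pow_mul_mul_pow_succ_le hP₀ hcomm hG hbound n 0 (by omega)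
    rw [pow_zero, mul_one] at h
    refine h.trans (mul_le_mul_of_nonneg_right ?_ hε0)
    push_cast
    linarith
end
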